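/- If v is a run in a word u whose shortest period is at least 2, and e denotes the exponent of v, then |H(v)| ≥ 2·(⌊e⌋ − 2), where H(v) is the set of handles of v. -/

import Mathlib

open scoped Classical

namespace RunsExp

variable {α : Type*}

/-- `p` is a period of the word `w`. -/
def IsPeriod (w : List α) (p : ℕ) : Prop :=
  0 < p ∧ ∀ i : ℕ, i + p < w.length → w[i]? = w[i + p]?

/-- The shortest period of the word `w`. -/
noncomputable def minPeriod (w : List α) : ℕ := sInf {p | IsPeriod w p}

/-- The factor `u[i..j]` of `u` (0-based indices, inclusive on both ends). -/
def factor (u : List α) (i j : ℕ) : List α := (u.drop i).take (j - i + 1)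

/-- `[i..j]` is a run in `u` (0-based indices): the shortest period `p` of `u[i..j]`
satisfies `2p ≤ j-i+1` and the interval can be extended neither to the left nor to
the right without violating this property. -/
def IsRun (u : List α) (i j : ℕ) : Prop :=
  i ≤ j ∧ j < u.length ∧
  2 * minPeriod (factor u i j) ≤ j - i + 1 ∧
  (i = 0 ∨ u[i - 1]? ≠ u[i + minPeriod (factor u i j) - 1]?) ∧
  (j = u.length - 1 ∨ u[j - minPeriod (factor u i j) + 1]? ≠ u[j + 1]?)

/-- The exponent of the run `[i..j]` of `u`. -/
noncomputable def exponent (u : List α) (i j : ℕ) : ℚ :=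
  ((j : ℚ) - (i : ℚ) + 1) / (minPeriod (factor u i j) : ℚ)

/-- The set of all runs of `u`, as a finset of pairs of indices. -/
noncomputable def runs (u : List α) : Finset (ℕ × ℕ) :=
  (Finset.range u.length ×ˢ Finset.range u.length).filter fun q => IsRun u q.1 q.2

/-- The sum of exponents of all runs in `u`. -/
noncomputable def sigma (u : List α) : ℚ :=
  ∑ q ∈ runs u, exponent u q.1 q.2

/-- The lexicographically minimal word cyclically equivalent to `w`. -/
noncomputable def minRot [LinearOrder α] (w : List α) : List α :=
  ((List.range w.length).map w.rotate).foldr min w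

/-- The lexicographically maximal word cyclically equivalent to `w`. -/
noncomputable def maxRot [LinearOrder α] (w : List α) : List α :=
  ((List.range w.length).map w.rotate).foldr max w

/-- The word `x` occurs in `u` at (0-based) starting position `s`, entirely within
the interval `[i..j]`. -/
def OccursAt (u : List α) (i j : ℕ) (x : List α) (s : ℕ) : Prop :=
  i ≤ s ∧ s + x.length ≤ j + 1 ∧ factor u s (s + x.length - 1) = x

/-- `s` and `s'` are starting positions of consecutive occurrences of `x`
inside the interval `[i..j]` of `u`. -/
def ConsecutiveOcc (u : List α) (i j : ℕ) (x : List α) (s s' : ℕ) : Prop :=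
  OccursAt u i j x s ∧ OccursAt u i j x s' ∧ s < s' ∧
    ∀ t, s < t → t < s' → ¬ OccursAt u i j x t

/-- The set of handles of the run `[i..j]` of `u`: inter-position `k` lies between
the letters at positions `k` and `k+1`.  If the minimal and maximal rotations of the
period-prefix `w` coincide, all inter-positions inside the run are handles; otherwise
the handles are the inter-positions between consecutive occurrences of the minimal
rotation and between consecutive occurrences of the maximal rotation. -/
noncomputable def handles [LinearOrder α] (u : List α) (i j : ℕ) : Set ℕ :=
  let p := minPeriod (factor u i j)
  let w := factor u i (i + p - 1)
  if minRot w = maxRot w then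
    {k | i ≤ k ∧ k < j}
  else
    {k | ∃ s s', (ConsecutiveOcc u i j (minRot w) s s' ∨
                  ConsecutiveOcc u i j (maxRot w) s s') ∧ k = s' - 1}

/-- `[i..j]` is a cubic run in `u`. -/
def IsCubicRun (u : List α) (i j : ℕ) : Prop :=
  IsRun u i j ∧ 3 * minPeriod (factor u i j) ≤ j - i + 1

/-- The set of all cubic runs of `u`. -/
noncomputable def cubicRuns (u : List α) : Finset (ℕ × ℕ) :=
  (Finset.range u.length ×ˢ Finset.range u.length).filter fun q => IsCubicRun u q.1 q.2

/-- The sum of exponents of all cubic runs in `u`. -/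
noncomputable def sigmaCubic (u : List α) : ℚ :=
  ∑ q ∈ cubicRuns u, exponent u q.1 q.2



theorem foldr_choice {β : Type*} (f : β → β → β) (hf : ∀ a b, f a b = a ∨ f a b = b)
    (a : β) (l : List β) : l.foldr f a = a ∨ l.foldr f a ∈ l := by
  induction l with
  | nil => simp
  | cons b l ih =>
    rw [List.foldr_cons]
    rcases hf b (l.foldr f a) with h | h <;> rw [h]
    · simp
    · rcases ih with h | h
      · exact Or.inl h
      · exact Or.inr (List.mem_cons_of_mem _ h)

theorem rot_of_choice (w : List α) (hw : 0 < w.length) (x : List α)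
    (h : x = w ∨ x ∈ (List.range w.length).map w.rotate) :
    ∃ k, k < w.length ∧ x = w.rotate k := by
  rcases h with h | h
  · exact ⟨0, hw, by simp [h]⟩
  · obtain ⟨k, hk, rfl⟩ := List.mem_map.1 h
    exact ⟨k, List.mem_range.1 hk, rfl⟩

theorem minRot_eq [LinearOrder α] (w : List α) (hw : 0 < w.length) :
    ∃ k, k < w.length ∧ minRot w = w.rotate k :=
  rot_of_choice w hw _ (foldr_choice _ min_choice _ _)

theorem maxRot_eq [LinearOrder α] (w : List α) (hw : 0 < w.length) :
    ∃ k, k < w.length ∧ maxRot w = w.rotate k :=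
  rot_of_choice w hw _ (foldr_choice _ max_choice _ _)

theorem factor_getElem? (u : List α) (a b t : ℕ) (h : t < b - a + 1) :
    (factor u a b)[t]? = u[a + t]? := by
  unfold factor
  rw [List.getElem?_take_of_lt h, List.getElem?_drop]

theorem factor_length (u : List α) (a b : ℕ) (hab : a ≤ b) (hb : b < u.length) :
    (factor u a b).length = b - a + 1 := by
  unfold factor
  rw [List.length_take, List.length_drop]
  omega

theorem period_mul (u : List α) (i n p : ℕ)
    (hper : ∀ t, t + p < n → u[i + t]? = u[i + (t + p)]?) (t m : ℕ) (h : t + m * p < n) :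
    u[i + (t + m * p)]? = u[i + t]? := by
  induction m with
  | zero => simp
  | succ m ih =>
    have e : t + (m + 1) * p = (t + m * p) + p := by ring
    rw [e] at h ⊢
    rw [← hper _ h]
    exact ih (by omega)

theorem occ_rot (u : List α) (i j p : ℕ) (hij : i ≤ j) (hj : j < u.length) (hp : 0 < p)
    (hpn : p ≤ j - i + 1)
    (hper : ∀ t, t + p < j - i + 1 → u[i + t]? = u[i + (t + p)]?)
    (k m : ℕ) (hm : k + m * p + p ≤ j - i + 1) :
    OccursAt u i j ((factor u i (i + p - 1)).rotate k) (i + k + m * p) := by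
  have hl : (factor u i (i + p - 1)).length = p := by
    rw [factor_length _ _ _ (by omega) (by omega)]; omega
  unfold OccursAt
  rw [List.length_rotate, hl]
  refine ⟨by omega, by omega, ?_⟩
  apply List.ext_getElem?
  intro t
  have hl2 : (factor u (i + k + m * p) (i + k + m * p + p - 1)).length = p := by
    rw [factor_length _ _ _ (by omega) (by omega)]; omega
  by_cases ht : t < p
  · rw [factor_getElem? _ _ _ _ (by omega), List.getElem?_rotate (by omega), hl]
    have hlt := Nat.mod_lt (t + k) hp
    rw [factor_getElem? _ _ _ _ (by omega)]
    have hd := Nat.mod_add_div' (t + k) p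
    have e : k + m * p + t = (t + k) % p + ((t + k) / p + m) * p := by
      rw [add_mul]; omega
    have := period_mul u i _ p hper ((t + k) % p) ((t + k) / p + m) (by omega)
    rw [← this, ← e]
    congr 1; omega
  · rw [List.getElem?_eq_none (by omega),
      List.getElem?_eq_none (by rw [List.length_rotate]; omega)]

theorem exists_prev (u : List α) (i j : ℕ) (x : List α) (s s' : ℕ)
    (h : OccursAt u i j x s) (h' : OccursAt u i j x s') (hlt : s < s') :
    ∃ r, ConsecutiveOcc u i j x r s' := by
  induction hd : s' - s using Nat.strong_induction_on generalizing s with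
  | _ d ih =>
    by_cases hc : ∃ t, s < t ∧ t < s' ∧ OccursAt u i j x t
    · obtain ⟨t, h1, h2, h3⟩ := hc
      exact ih (s' - t) (by omega) t h3 h2 rfl
    · exact ⟨s, h, h', hlt, fun t h1 h2 h3 => hc ⟨t, h1, h2, h3⟩⟩

/-- If `v = [i..j]` is a run in `u` with shortest period at least `2` and exponent
`e`, then `|H(v)| ≥ 2(⌊e⌋ - 2)`. -/
theorem handles_card_ge [LinearOrder α] (u : List α) (i j : ℕ)
    (hrun : IsRun u i j) (hp : 2 ≤ minPeriod (factor u i j)) :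
    (((handles u i j).ncard : ℤ)) ≥ 2 * (⌊exponent u i j⌋ - 2) := by
  obtain ⟨hij, hj, h2, -, -⟩ := hrun
  have hmem : IsPeriod (factor u i j) (minPeriod (factor u i j)) :=
    Nat.sInf_mem (Nat.nonempty_of_pos_sInf (lt_of_lt_of_le Nat.zero_lt_two hp))
  have hE : ⌊exponent u i j⌋ = (((j - i + 1) / minPeriod (factor u i j) : ℕ) : ℤ) := by
    unfold exponent
    have : ((j : ℚ) - (i : ℚ) + 1) = ((j - i + 1 : ℕ) : ℚ) := by
      push_cast [Nat.cast_sub hij]; ring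
    rw [this]
    exact Rat.floor_natCast_div_natCast _ _
  rw [hE]
  unfold handles
  simp only
  generalize minPeriod (factor u i j) = p at *
  have hper : ∀ t, t + p < j - i + 1 → u[i + t]? = u[i + (t + p)]? := by
    intro t ht
    have := hmem.2 t (by rw [factor_length _ _ _ hij hj]; exact ht)
    rwa [factor_getElem? _ _ _ _ (by omega), factor_getElem? _ _ _ _ ht] at this
  have hl : (factor u i (i + p - 1)).length = p := by
    rw [factor_length _ _ _ (by omega) (by omega)]; omega
  have hdiv : (j - i + 1) / p * p ≤ j - i + 1 := Nat.div_mul_le_self _ _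
  have he2 : 2 ≤ (j - i + 1) / p := (Nat.le_div_iff_mul_le (by omega)).2 h2
  generalize (j - i + 1) / p = e at *
  have hocc := occ_rot u i j p hij hj (by omega) (by omega) hper
  generalize factor u i (i + p - 1) = w at *
  split_ifs with hmm
  · have : {k | i ≤ k ∧ k < j} = Set.Ico i j := rfl
    rw [this, ← Finset.coe_Ico, Set.ncard_coe_finset, Nat.card_Ico]
    have : e * 2 ≤ e * p := Nat.mul_le_mul_left _ hp
    omega
  · obtain ⟨a, ha, hae⟩ := minRot_eq w (by omega)
    obtain ⟨b, hb, hbe⟩ := maxRot_eq w (by omega)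
    rw [hae, hbe] at hmm ⊢
    rw [hl] at ha hb
    have hab : a ≠ b := fun h => hmm (by rw [h])
    have key : ∀ c, c < p → ∀ m, m < e - 2 → 
        ∃ r, ConsecutiveOcc u i j (w.rotate c) r (i + c + (m + 1) * p) := by
      intro c hc m hm
      have h3 : (m + 3) * p ≤ e * p := Nat.mul_le_mul_right _ (by omega)
      have h4 : (m + 3) * p = m * p + 3 * p := by ring
      have h5 : (m + 1) * p = m * p + p := by ring
      exact exists_prev u i j _ _ _ (hocc c m (by omega)) (hocc c (m + 1) (by omega)) (by omega)
    let f : ℕ × ℕ → ℕ := fun q => i + q.1 + (q.2 + 1) * p - 1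
    have hinj : Set.InjOn f ((({a, b} : Finset ℕ) ×ˢ Finset.range (e - 2) : Finset (ℕ × ℕ)) : Set (ℕ × ℕ)) := by
      rintro ⟨c, m⟩ hq ⟨c', m'⟩ hq' hf
      simp only [Finset.coe_product, Set.mem_prod, Finset.mem_coe, Finset.mem_insert,
        Finset.mem_singleton] at hq hq'
      have hc : c < p := by rcases hq.1 with h | h <;> omega
      have hc' : c' < p := by rcases hq'.1 with h | h <;> omega
      have h5 : (m + 1) * p = m * p + p := by ring
      have h5' : (m' + 1) * p = m' * p + p := by ring
      have hh : c + m * p = c' + m' * p := by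
        simp only [f] at hf; omega
      have h6 : c = c' := by
        have := congrArg (· % p) hh
        simpa [Nat.add_mul_mod_self_right, Nat.mod_eq_of_lt hc, Nat.mod_eq_of_lt hc'] using this
      subst h6
      have h7 : m = m' := Nat.eq_of_mul_eq_mul_right (by omega) (Nat.add_left_cancel hh)
      rw [h7]
    have hsub : ((((({a, b} : Finset ℕ) ×ˢ Finset.range (e - 2)).image f : Finset ℕ)) : Set ℕ) ⊆
        {k | ∃ s s', (ConsecutiveOcc u i j (w.rotate a) s s' ∨
                  ConsecutiveOcc u i j (w.rotate b) s s') ∧ k = s' - 1} := by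
      intro k hk
      simp only [Finset.coe_image, Set.mem_image, Finset.mem_coe, Finset.mem_product,
        Finset.mem_insert, Finset.mem_singleton, Finset.mem_range] at hk
      obtain ⟨⟨c, m⟩, ⟨hc, hm⟩, rfl⟩ := hk
      rcases hc with rfl | rfl
      · obtain ⟨r, hr⟩ := key _ ha m hm
        exact ⟨r, _, Or.inl hr, rfl⟩
      · obtain ⟨r, hr⟩ := key _ hb m hm
        exact ⟨r, _, Or.inr hr, rfl⟩
    have hfin : {k | ∃ s s', (ConsecutiveOcc u i j (w.rotate a) s s' ∨
                  ConsecutiveOcc u i j (w.rotate b) s s') ∧ k = s' - 1}.Finite := by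
      apply (Set.finite_Iio (j + 1)).subset
      rintro k ⟨s, s', h, rfl⟩
      have : s' + w.length ≤ j + 1 := by
        rcases h with h | h <;> simpa using h.2.1.2.1
      simp only [Set.mem_Iio]
      omega
    have hle := Set.ncard_le_ncard hsub hfin
    rw [Set.ncard_coe_finset, Finset.card_image_of_injOn hinj, Finset.card_product,
      Finset.card_pair hab, Finset.card_range] at hle
    omega
end RunsExp
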